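/- arXiv:2204.05359 — 6 statements merged into one kernel-verified Lean document; each statement's English description precedes it below -/
import Mathlib

section
/- Let M ∈ ℝ^{n×n} be a nonnegative matrix with spectral radius ρ(M) > 0. Then inf{ max_i δ_ii : Δ a diagonal matrix with nonnegative diagonal entries such that I − ΔM is singular } = 1/ρ(M), and this infimum is attained by Δ = (1/ρ(M))·I; consequently μ_C(M) = ρ(M). -/
open Matrix BigOperators

/-- The spectral radius of a real square matrix: the maximum modulus of its
complex eigenvalues. -/
noncomputable def specRad {n : ℕ} (M : Matrix (Fin n) (Fin n) ℝ) : ℝ :=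
  (spectralRadius ℂ (M.map (Complex.ofReal ·))).toReal

/-- `μ_C(M)`: the reciprocal of the minimal value of `max_i δ_ii` over nonnegative
diagonal perturbations `Δ` making `I - Δ M` singular (`μ_C(M) = 0` if no such `Δ`
exists). -/
noncomputable def muC {n : ℕ} (M : Matrix (Fin n) (Fin n) ℝ) : ℝ :=
  (sInf {s : ℝ | ∃ δ : Fin n → ℝ, (∀ i, 0 ≤ δ i) ∧
      (1 - Matrix.diagonal δ * M).det = 0 ∧ s = ⨆ i, δ i})⁻¹

open Filter Topology

section Helpers

attribute [local instance] Matrix.linftyOpNormedRing Matrix.linftyOpNormedAlgebra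

theorem spectralRadius_eq_ofReal_specRad {n : ℕ} {M : Matrix (Fin n) (Fin n) ℝ}
    (hρ : 0 < specRad M) :
    spectralRadius ℂ (M.map (Complex.ofReal ·)) = ENNReal.ofReal (specRad M) := by
  refine (ENNReal.ofReal_toReal fun h => ?_).symm
  simp [specRad, h] at hρ

theorem tendsto_inv_pow_mul_pow_apply_zero {n : ℕ} {M : Matrix (Fin n) (Fin n) ℝ}
    (hρ : 0 < specRad M) {t : ℝ} (ht : specRad M < t) (i j : Fin n) :
    Tendsto (fun k : ℕ => (t ^ k)⁻¹ * (M ^ k) i j) atTop (𝓝 0) := by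
  have : CompleteSpace (Matrix (Fin n) (Fin n) ℂ) := FiniteDimensional.complete ℂ _
  obtain ⟨r, hr, hrt⟩ := exists_between ht
  have hr0 : 0 < r := hρ.trans hr
  have ht0 : 0 < t := hr0.trans hrt
  set A : Matrix (Fin n) (Fin n) ℂ := M.map (Complex.ofReal ·) with hA
  have hpow (k : ℕ) : (A ^ k) i j = ((M ^ k) i j : ℂ) := by
    have h := congrFun₂ (map_pow (Complex.ofRealHom.mapMatrix (m := Fin n)) M k) i j
    exact h.symm
  have hentry (B : Matrix (Fin n) (Fin n) ℂ) : ‖B i j‖ ≤ ‖B‖ := by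
    have h₁ : (∑ j, ‖B i j‖₊) ≤ ‖B‖₊ := by
      rw [Matrix.linfty_opNNNorm_def]
      exact Finset.le_sup (f := fun i => ∑ j, ‖B i j‖₊) (Finset.mem_univ i)
    exact_mod_cast (Finset.single_le_sum (f := fun j => ‖B i j‖₊) (fun _ _ => zero_le)
      (Finset.mem_univ j)).trans h₁
  have hg := spectrum.pow_norm_pow_one_div_tendsto_nhds_spectralRadius A
  rw [spectralRadius_eq_ofReal_specRad hρ] at hg
  have hev := hg.eventually_lt_const ((ENNReal.ofReal_lt_ofReal_iff hr0).2 hr)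
  refine squeeze_zero_norm' ?_ (tendsto_pow_atTop_nhds_zero_of_lt_one
    (div_nonneg hr0.le ht0.le) ((div_lt_one ht0).2 hrt))
  filter_upwards [hev, eventually_gt_atTop 0] with k hk hk0
  have hk' := (ENNReal.ofReal_lt_ofReal_iff hr0).1 hk
  have hle : ‖A ^ k‖ ≤ r ^ k := by
    have h := pow_le_pow_left₀ (by positivity) hk'.le k
    rwa [one_div, Real.rpow_inv_natCast_pow (norm_nonneg _) hk0.ne'] at h
  have hMk : ‖(M ^ k) i j‖ ≤ r ^ k := by
    have h := (hentry (A ^ k)).trans hle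
    rwa [hpow, Complex.norm_real] at h
  rw [norm_mul, norm_inv, norm_pow, Real.norm_of_nonneg ht0.le, div_pow, div_eq_inv_mul]
  gcongr

theorem exists_mem_spectrum_norm_eq_specRad {n : ℕ} (hn : 1 ≤ n)
    (M : Matrix (Fin n) (Fin n) ℝ) :
    ∃ z ∈ spectrum ℂ (M.map (Complex.ofReal ·)), ‖z‖ = specRad M := by
  have : CompleteSpace (Matrix (Fin n) (Fin n) ℂ) := FiniteDimensional.complete ℂ _
  have : Nonempty (Fin n) := ⟨⟨0, hn⟩⟩
  obtain ⟨z, hz, h⟩ := spectrum.exists_nnnorm_eq_spectralRadius (M.map (Complex.ofReal ·))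
  exact ⟨z, hz, by simp [specRad, ← h]⟩

end Helpers

theorem mulVec_mono_of_nonneg {n : ℕ} {M : Matrix (Fin n) (Fin n) ℝ}
    (hM : ∀ i j, 0 ≤ M i j) {x y : Fin n → ℝ} (h : x ≤ y) : M *ᵥ x ≤ M *ᵥ y := by
  intro i
  simp only [mulVec, dotProduct]
  exact Finset.sum_le_sum fun j _ => mul_le_mul_of_nonneg_left (h j) (hM i j)

theorem nonneg_of_mulVec_le_smul {n : ℕ} {M : Matrix (Fin n) (Fin n) ℝ}
    (hM : ∀ i j, 0 ≤ M i j) (hρ : 0 < specRad M) {t : ℝ} (ht : specRad M < t)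
    {x : Fin n → ℝ} (hx : M *ᵥ x ≤ t • x) : 0 ≤ x := by
  have ht0 : 0 < t := hρ.trans ht
  have hpow (k : ℕ) : (M ^ k) *ᵥ x ≤ t ^ k • x := by
    induction k with
    | zero => simp
    | succ k ih =>
      rw [pow_succ', ← mulVec_mulVec]
      refine (mulVec_mono_of_nonneg hM ih).trans ?_
      rw [mulVec_smul, pow_succ, mul_smul]
      exact smul_le_smul_of_nonneg_left hx (by positivity)
  intro i
  have hlim : Tendsto (fun k : ℕ => ∑ j, (t ^ k)⁻¹ * (M ^ k) i j * x j) atTop (𝓝 0) := by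
    simpa using tendsto_finsetSum Finset.univ fun j _ =>
      (tendsto_inv_pow_mul_pow_apply_zero hρ ht i j).mul_const (x j)
  refine le_of_tendsto hlim (Eventually.of_forall fun k => ?_)
  have h := hpow k i
  simp only [Pi.smul_apply, smul_eq_mul] at h
  simp only [mul_assoc, ← Finset.mul_sum]
  rw [inv_mul_le_iff₀ (by positivity)]
  exact h

theorem exists_nonneg_specRad_smul_le_mulVec {n : ℕ} (hn : 1 ≤ n)
    {M : Matrix (Fin n) (Fin n) ℝ} (hM : ∀ i j, 0 ≤ M i j) :
    ∃ w : Fin n → ℝ, 0 ≤ w ∧ w ≠ 0 ∧ specRad M • w ≤ M *ᵥ w := by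
  obtain ⟨z, hz, hzρ⟩ := exists_mem_spectrum_norm_eq_specRad hn M
  rw [← Matrix.spectrum_toLin', ← Module.End.hasEigenvalue_iff_mem_spectrum] at hz
  obtain ⟨v, hv⟩ := hz.exists_hasEigenvector
  refine ⟨fun i => ‖v i‖, fun i => norm_nonneg _, fun h => hv.2 ?_, fun i => ?_⟩
  · ext i
    simpa using congrFun h i
  · have h := congrFun hv.apply_eq_smul i
    rw [Matrix.toLin'_apply] at h
    simp only [Pi.smul_apply, smul_eq_mul] at h ⊢
    rw [← hzρ, ← norm_mul, ← h]
    simp only [mulVec, dotProduct]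
    refine (norm_sum_le _ _).trans (Finset.sum_le_sum fun j _ => ?_)
    simp [abs_of_nonneg (hM i j)]

theorem det_specRad_smul_one_sub_eq_zero {n : ℕ} (hn : 1 ≤ n) {M : Matrix (Fin n) (Fin n) ℝ}
    (hM : ∀ i j, 0 ≤ M i j) (hρ : 0 < specRad M) :
    (specRad M • (1 : Matrix (Fin n) (Fin n) ℝ) - M).det = 0 := by
  by_contra hdet
  obtain ⟨w, hw, hw0, hwM⟩ := exists_nonneg_specRad_smul_le_mulVec hn hM
  set ρ := specRad M with hρdef
  let B : ℝ → Matrix (Fin n) (Fin n) ℝ := fun t => t • 1 - M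
  have hB : Continuous B := by fun_prop
  have hBdet : Continuous fun t => (B t).det := hB.matrix_det
  let u : ℝ → Fin n → ℝ := fun t => (t - ρ) • ((B t).det⁻¹ • ((B t).adjugate *ᵥ w))
  have hu : ContinuousAt u ρ :=
    (continuousAt_id.sub continuousAt_const).smul
      ((hBdet.continuousAt.inv₀ hdet).smul
        (hB.matrix_adjugate.matrix_mulVec continuous_const).continuousAt)
  have hlim : Tendsto u (𝓝[>] ρ) (𝓝 0) := by
    have h := hu.tendsto.mono_left (nhdsWithin_le_nhds (s := Set.Ioi ρ))
    simpa [u] using h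
  have hle : ∀ᶠ t in 𝓝[>] ρ, w ≤ u t := by
    filter_upwards [self_mem_nhdsWithin,
      nhdsWithin_le_nhds (hBdet.continuousAt.eventually_ne hdet)] with t ht htdet
    rw [← sub_nonneg]
    refine nonneg_of_mulVec_le_smul hM hρ ht ?_
    have hBu : B t *ᵥ u t = (t - ρ) • w := by
      simp only [u, mulVec_smul, mulVec_mulVec, mul_adjugate, smul_mulVec, one_mulVec]
      rw [inv_smul_smul₀ htdet]
    have hBu' : t • u t - M *ᵥ u t = (t - ρ) • w := by
      rw [← hBu]
      simp [B, sub_mulVec, smul_mulVec]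
    intro i
    have h₁ := congrFun hBu' i
    have h₂ := hwM i
    simp only [mulVec_sub, Pi.sub_apply, Pi.smul_apply, smul_eq_mul] at h₁ h₂ ⊢
    linarith
  exact hw0 (le_antisymm (ge_of_tendsto hlim hle) hw)

theorem inv_specRad_le_of_det_eq_zero {n : ℕ} {M : Matrix (Fin n) (Fin n) ℝ}
    (hM : ∀ i j, 0 ≤ M i j) (hρ : 0 < specRad M) {δ : Fin n → ℝ} (hδ : ∀ i, 0 ≤ δ i)
    (hdet : (1 - Matrix.diagonal δ * M).det = 0) {s : ℝ} (hs : ∀ i, δ i ≤ s) :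
    (specRad M)⁻¹ ≤ s := by
  obtain ⟨v, hv0, hv⟩ := Matrix.exists_mulVec_eq_zero_iff.2 hdet
  by_contra! hlt
  have hw (i : Fin n) : |v i| ≤ s * (M *ᵥ fun j => |v j|) i := by
    have h : v i = δ i * (M *ᵥ v) i := by
      have h := congrFun hv i
      rw [sub_mulVec, one_mulVec, ← mulVec_mulVec, Pi.sub_apply, mulVec_diagonal] at h
      exact sub_eq_zero.1 h
    have habs : |(M *ᵥ v) i| ≤ (M *ᵥ fun j => |v j|) i := by
      simp only [mulVec, dotProduct]
      refine (Finset.abs_sum_le_sum_abs _ _).trans (Finset.sum_le_sum fun j _ => ?_)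
      rw [abs_mul, abs_of_nonneg (hM i j)]
    rw [h, abs_mul, abs_of_nonneg (hδ i)]
    exact mul_le_mul (hs i) habs (abs_nonneg _) ((hδ i).trans (hs i))
  obtain ⟨i₀, hi₀⟩ := Function.ne_iff.1 hv0
  have hs0 : 0 < s := by
    refine ((hδ i₀).trans (hs i₀)).lt_of_ne fun h => hi₀ ?_
    have h' := hw i₀
    rw [← h, zero_mul] at h'
    simpa using h'
  have hx : 0 ≤ -fun j => |v j| := by
    refine nonneg_of_mulVec_le_smul hM hρ ((lt_inv_comm₀ hs0 hρ).1 hlt) fun i => ?_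
    have h := (inv_mul_le_iff₀ hs0).2 (hw i)
    simpa [mulVec_neg] using h
  exact hi₀ (by simpa using hx i₀)

/-- Let `M` be nonnegative with `ρ(M) > 0`.  Then the infimum of `max_i δ_ii` over
nonnegative diagonal `Δ` making `I - ΔM` singular equals `1/ρ(M)`, the infimum is
attained by `Δ = ρ(M)⁻¹ · I` (i.e. `I - ρ(M)⁻¹ I · M` is singular), and hence
`μ_C(M) = ρ(M)`. -/
theorem muC_eq_specRad {n : ℕ} (hn : 1 ≤ n) (M : Matrix (Fin n) (Fin n) ℝ)
    (hM : ∀ i j, 0 ≤ M i j) (hρ : 0 < specRad M) :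
    sInf {s : ℝ | ∃ δ : Fin n → ℝ, (∀ i, 0 ≤ δ i) ∧
        (1 - Matrix.diagonal δ * M).det = 0 ∧ s = ⨆ i, δ i} = 1 / specRad M ∧
    (1 - Matrix.diagonal (fun _ : Fin n => (specRad M)⁻¹) * M).det = 0 ∧
    muC M = specRad M := by
  have : Nonempty (Fin n) := ⟨⟨0, hn⟩⟩
  have hdet : (1 - Matrix.diagonal (fun _ : Fin n => (specRad M)⁻¹) * M).det = 0 := by
    have h : 1 - Matrix.diagonal (fun _ : Fin n => (specRad M)⁻¹) * M =
        (specRad M)⁻¹ • (specRad M • (1 : Matrix (Fin n) (Fin n) ℝ) - M) := by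
      rw [smul_sub, inv_smul_smul₀ hρ.ne', ← smul_one_eq_diagonal, smul_mul_assoc, one_mul]
    rw [h, det_smul, det_specRad_smul_one_sub_eq_zero hn hM hρ, mul_zero]
  have hinf : sInf {s : ℝ | ∃ δ : Fin n → ℝ, (∀ i, 0 ≤ δ i) ∧
      (1 - Matrix.diagonal δ * M).det = 0 ∧ s = ⨆ i, δ i} = 1 / specRad M := by
    rw [one_div]
    refine IsLeast.csInf_eq ⟨⟨_, fun _ => (inv_pos.2 hρ).le, hdet, ciSup_const.symm⟩, ?_⟩
    rintro s ⟨δ, hδ, hδdet, rfl⟩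
    exact inv_specRad_le_of_det_eq_zero hM hρ hδ hδdet
      (le_ciSup (Set.finite_range δ).bddAbove)
  exact ⟨hinf, hdet, by rw [muC, hinf, one_div, inv_inv]⟩
end

section
/- For every nonnegative matrix M ∈ ℝ^{n×n}, ν_C(M) ≤ ν̄(M); equivalently, every diagonal Δ with nonnegative diagonal entries making I − ΔM singular satisfies δ_11 + … + δ_nn ≥ 1/ν̄(M). -/
open Matrix BigOperators

/-- `ν_C(M)`: the reciprocal of the minimal trace of a nonnegative diagonal
perturbation `Δ` making `I - Δ M` singular (`ν_C(M) = 0` if no such `Δ` exists). -/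
noncomputable def nuC {n : ℕ} (M : Matrix (Fin n) (Fin n) ℝ) : ℝ :=
  (sInf {s : ℝ | ∃ δ : Fin n → ℝ, (∀ i, 0 ≤ δ i) ∧
      (1 - Matrix.diagonal δ * M).det = 0 ∧ s = ∑ i, δ i})⁻¹

/-- `ν̄(M) = inf { max_{i,j} M_ij d_i / d_j : d ∈ ℝ^n, d_i > 0 }`. -/
noncomputable def nuBar {n : ℕ} (M : Matrix (Fin n) (Fin n) ℝ) : ℝ :=
  sInf {v : ℝ | ∃ d : Fin n → ℝ, (∀ i, 0 < d i) ∧ v = ⨆ i, ⨆ j, M i j * d i / d j}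

/-- If `I - ΔM` is singular with `Δ ≥ 0` diagonal, every diagonal scaling of `M` has an
entry of size at least `1 / tr Δ`. -/
theorem one_le_iSup_scaled_mul_sum {n : ℕ} {M : Matrix (Fin n) (Fin n) ℝ}
    (hM : ∀ i j, 0 ≤ M i j) {δ : Fin n → ℝ} (hδ : ∀ i, 0 ≤ δ i)
    (hdet : (1 - Matrix.diagonal δ * M).det = 0) {d : Fin n → ℝ} (hd : ∀ i, 0 < d i) :
    1 ≤ (⨆ i, ⨆ j, M i j * d i / d j) * ∑ i, δ i := by
  set v := ⨆ i, ⨆ j, M i j * d i / d j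
  have hv : ∀ i j, M i j * d i / d j ≤ v := fun i j =>
    (le_ciSup (Set.finite_range fun j => M i j * d i / d j).bddAbove j).trans
      (le_ciSup (Set.finite_range fun i => ⨆ j, M i j * d i / d j).bddAbove i)
  obtain ⟨x, hx0, hx⟩ := Matrix.exists_mulVec_eq_zero_iff.mpr hdet
  have hfix : ∀ i, x i = δ i * ∑ j, M i j * x j := by
    intro i
    have h := congrFun hx i
    rw [Matrix.sub_mulVec, Matrix.one_mulVec, ← Matrix.mulVec_mulVec, Pi.sub_apply,
      Matrix.mulVec_diagonal, Pi.zero_apply, sub_eq_zero] at h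
    exact h
  have hrow : ∀ i, d i * |x i| ≤ δ i * (v * ∑ j, d j * |x j|) := by
    intro i
    calc d i * |x i| = δ i * (d i * |∑ j, M i j * x j|) := by
          conv_lhs => rw [hfix i, abs_mul, abs_of_nonneg (hδ i)]
          ring
      _ ≤ δ i * (d i * ∑ j, |M i j * x j|) := by
          have := hδ i
          have := (hd i).le
          gcongr
          exact Finset.abs_sum_le_sum_abs _ _
      _ = δ i * ∑ j, M i j * d i / d j * (d j * |x j|) := by
          rw [Finset.mul_sum]
          congr 1
          refine Finset.sum_congr rfl fun j _ => ?_
          have := (hd j).ne'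
          rw [abs_mul, abs_of_nonneg (hM i j)]
          field_simp
      _ ≤ δ i * (v * ∑ j, d j * |x j|) := by
          rw [Finset.mul_sum _ _ v]
          refine mul_le_mul_of_nonneg_left (Finset.sum_le_sum fun j _ => ?_) (hδ i)
          exact mul_le_mul_of_nonneg_right (hv i j) (mul_nonneg (hd j).le (abs_nonneg _))
  have hpos : 0 < ∑ j, d j * |x j| := by
    obtain ⟨k, hk⟩ := Function.ne_iff.mp hx0
    exact Finset.sum_pos' (fun j _ => mul_nonneg (hd j).le (abs_nonneg _))
      ⟨k, Finset.mem_univ k, mul_pos (hd k) (abs_pos.mpr hk)⟩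
  refine le_of_mul_le_mul_right ?_ hpos
  calc 1 * ∑ j, d j * |x j| ≤ ∑ i, δ i * (v * ∑ j, d j * |x j|) := by
        rw [one_mul]
        exact Finset.sum_le_sum fun i _ => hrow i
    _ = v * (∑ i, δ i) * ∑ j, d j * |x j| := by
        rw [← Finset.sum_mul]
        ring

theorem nuBar_nonneg {n : ℕ} {M : Matrix (Fin n) (Fin n) ℝ} (hM : ∀ i j, 0 ≤ M i j) :
    0 ≤ nuBar M := by
  refine Real.sInf_nonneg ?_
  rintro _ ⟨d, hd, rfl⟩
  exact Real.iSup_nonneg fun i => Real.iSup_nonneg fun j =>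
    div_nonneg (mul_nonneg (hM i j) (hd i).le) (hd j).le

theorem nuBar_pos_and_one_div_le_sum {n : ℕ} {M : Matrix (Fin n) (Fin n) ℝ}
    (hM : ∀ i j, 0 ≤ M i j) {δ : Fin n → ℝ} (hδ : ∀ i, 0 ≤ δ i)
    (hdet : (1 - Matrix.diagonal δ * M).det = 0) :
    0 < nuBar M ∧ 1 / nuBar M ≤ ∑ i, δ i := by
  have hδpos : 0 < ∑ i, δ i := by
    refine (Finset.sum_nonneg fun i _ => hδ i).lt_of_ne fun h => ?_
    have := one_le_iSup_scaled_mul_sum hM hδ hdet (d := fun _ => 1) fun _ => one_pos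
    rw [← h, mul_zero] at this
    linarith
  have hle : 1 / ∑ i, δ i ≤ nuBar M := by
    refine le_csInf ⟨_, fun _ => 1, fun _ => one_pos, rfl⟩ ?_
    rintro _ ⟨d, hd, rfl⟩
    exact (div_le_iff₀ hδpos).mpr (one_le_iSup_scaled_mul_sum hM hδ hdet hd)
  have hpos : 0 < nuBar M := (one_div_pos.mpr hδpos).trans_le hle
  exact ⟨hpos, (one_div_le hδpos hpos).mp hle⟩

/-- For every nonnegative matrix `M`, `ν_C(M) ≤ ν̄(M)`; equivalently, every
nonnegative diagonal `Δ` making `I - ΔM` singular satisfies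
`δ_11 + ⋯ + δ_nn ≥ 1/ν̄(M)`. -/
theorem nuC_le_nuBar {n : ℕ} (hn : 1 ≤ n) (M : Matrix (Fin n) (Fin n) ℝ)
    (hM : ∀ i j, 0 ≤ M i j) :
    nuC M ≤ nuBar M ∧
      ∀ δ : Fin n → ℝ, (∀ i, 0 ≤ δ i) → (1 - Matrix.diagonal δ * M).det = 0 →
        1 / nuBar M ≤ ∑ i, δ i := by
  refine ⟨?_, fun δ hδ hdet => (nuBar_pos_and_one_div_le_sum hM hδ hdet).2⟩
  by_cases hS : ∃ δ : Fin n → ℝ, (∀ i, 0 ≤ δ i) ∧ (1 - Matrix.diagonal δ * M).det = 0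
  · obtain ⟨δ, hδ, hdet⟩ := hS
    have hpos := (nuBar_pos_and_one_div_le_sum hM hδ hdet).1
    refine inv_le_of_inv_le₀ hpos (le_csInf ⟨_, δ, hδ, hdet, rfl⟩ ?_)
    rintro _ ⟨ε, hε, hdet', rfl⟩
    exact one_div (nuBar M) ▸ (nuBar_pos_and_one_div_le_sum hM hε hdet').2
  · have hempty : {s : ℝ | ∃ δ : Fin n → ℝ, (∀ i, 0 ≤ δ i) ∧
        (1 - Matrix.diagonal δ * M).det = 0 ∧ s = ∑ i, δ i} = ∅ := by
      refine Set.eq_empty_of_forall_notMem ?_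
      rintro _ ⟨δ, hδ, hdet, -⟩
      exact hS ⟨δ, hδ, hdet⟩
    rw [nuC, hempty, Real.sInf_empty, _root_.inv_zero]
    exact nuBar_nonneg hM
end

section
/- Let M ∈ ℝ^{n×n} be nonnegative. If there exists a diagonal matrix D with strictly positive diagonal entries such that D M D^{-1} is diagonally maximal (its maximum entry is attained at a diagonal position), then ν̄(M) = ν_C(M). -/
open Matrix BigOperators

/-- A nonnegative matrix `A` is diagonally maximal if its maximum entry is
attained at a diagonal position: `max_{i,j} A_ij = max_i A_ii`. -/
def DiagonallyMaximal {n : ℕ} (A : Matrix (Fin n) (Fin n) ℝ) : Prop :=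
  (⨆ i, ⨆ j, A i j) = ⨆ i, A i i

/-- If the entries of `D M D⁻¹` are at most `m`, every nonnegative diagonal `Δ` making `I - Δ M`
singular satisfies `1 ≤ m * trace Δ`. -/
lemma one_le_mul_sum_of_det_one_sub_diagonal_mul_eq_zero {ι : Type*} [Fintype ι] [DecidableEq ι]
    {M : Matrix ι ι ℝ} (hM : ∀ i j, 0 ≤ M i j) {d : ι → ℝ} (hd : ∀ i, 0 < d i) {m : ℝ}
    (hm : ∀ i j, M i j * d i / d j ≤ m) {δ : ι → ℝ} (hδ : ∀ i, 0 ≤ δ i)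
    (hdet : (1 - Matrix.diagonal δ * M).det = 0) : 1 ≤ m * ∑ i, δ i := by
  obtain ⟨x, hx, hMx⟩ := Matrix.exists_mulVec_eq_zero_iff.mpr hdet
  have hfix (i : ι) : x i = δ i * ∑ j, M i j * x j := by
    have := congrFun hMx i
    rw [Matrix.sub_mulVec, Matrix.one_mulVec, ← Matrix.mulVec_mulVec, Pi.sub_apply,
      Matrix.mulVec_diagonal, Pi.zero_apply, sub_eq_zero] at this
    exact this
  have hrow (i : ι) : d i * |x i| ≤ δ i * (m * ∑ j, d j * |x j|) := by
    calc d i * |x i| = δ i * (d i * |∑ j, M i j * x j|) := by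
          conv_lhs => rw [hfix i, abs_mul, abs_of_nonneg (hδ i)]
          ring
      _ ≤ δ i * (d i * ∑ j, M i j * |x j|) := by
          gcongr
          · exact hδ i
          · exact (hd i).le
          · refine (Finset.abs_sum_le_sum_abs _ _).trans_eq ?_
            exact Finset.sum_congr rfl fun j _ => by rw [abs_mul, abs_of_nonneg (hM i j)]
      _ ≤ δ i * (m * ∑ j, d j * |x j|) := by
          refine mul_le_mul_of_nonneg_left ?_ (hδ i)
          rw [Finset.mul_sum, Finset.mul_sum]
          refine Finset.sum_le_sum fun j _ => ?_
          have := mul_le_mul_of_nonneg_right ((div_le_iff₀ (hd j)).mp (hm i j)) (abs_nonneg (x j))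
          linarith
  have hpos : 0 < ∑ j, d j * |x j| := by
    obtain ⟨k, hk⟩ := Function.ne_iff.mp hx
    exact Finset.sum_pos' (fun j _ => mul_nonneg (hd j).le (abs_nonneg _))
      ⟨k, Finset.mem_univ k, mul_pos (hd k) (abs_pos.mpr hk)⟩
  have hsum := Finset.sum_le_sum fun i (_ : i ∈ Finset.univ) => hrow i
  rw [← Finset.sum_mul] at hsum
  refine le_of_mul_le_mul_right ?_ hpos
  linarith

/-- `I - Δ M` is singular when `Δ` has the single nonzero entry `(M k k)⁻¹`, at position `k`. -/
lemma det_one_sub_diagonal_single_inv_mul {ι : Type*} [Fintype ι] [DecidableEq ι]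
    (M : Matrix ι ι ℝ) {k : ι} (hk : M k k ≠ 0) :
    (1 - Matrix.diagonal (Pi.single k (M k k)⁻¹) * M).det = 0 := by
  refine Matrix.exists_vecMul_eq_zero_iff.mp ⟨M k, Function.ne_iff.mpr ⟨k, hk⟩, ?_⟩
  ext j
  rw [Matrix.vecMul_sub, Matrix.vecMul_one, ← Matrix.vecMul_vecMul]
  simp only [Pi.sub_apply, Pi.zero_apply, Matrix.vecMul, dotProduct, Matrix.diagonal_apply]
  rw [Finset.sum_eq_single k]
  · simp [hk]
  · intro b _ hb
    simp [hb]
  · simp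

lemma le_ciSup_ciSup_of_finite {ι κ : Type*} [Finite ι] [Finite κ] (f : ι → κ → ℝ) (i : ι)
    (j : κ) : f i j ≤ ⨆ i, ⨆ j, f i j :=
  (le_ciSup (Set.finite_range (f i)).bddAbove j).trans
    (le_ciSup (f := fun i => ⨆ j, f i j) (Set.finite_range _).bddAbove i)

/-- If the maximal entry of `D M D⁻¹` is the diagonal entry at `k`, then `ν̄(M) = M k k`. -/
lemma nuBar_eq_apply_self {n : ℕ} (M : Matrix (Fin n) (Fin n) ℝ) {d : Fin n → ℝ}
    (hd : ∀ i, 0 < d i) {k : Fin n} (hk : ⨆ i, ⨆ j, M i j * d i / d j = M k k) :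
    nuBar M = M k k := by
  refine IsLeast.csInf_eq ⟨⟨d, hd, hk.symm⟩, ?_⟩
  rintro v ⟨e, he, rfl⟩
  have := le_ciSup_ciSup_of_finite (fun i j => M i j * e i / e j) k k
  rwa [mul_div_assoc, div_self (he k).ne', mul_one] at this

/-- If the maximal entry of `D M D⁻¹` is the diagonal entry at `k`, then `ν_C(M) = M k k`. -/
lemma nuC_eq_apply_self {n : ℕ} {M : Matrix (Fin n) (Fin n) ℝ} (hM : ∀ i j, 0 ≤ M i j)
    {d : Fin n → ℝ} (hd : ∀ i, 0 < d i) {k : Fin n}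
    (hk : ∀ i j, M i j * d i / d j ≤ M k k) : nuC M = M k k := by
  have hlower {δ : Fin n → ℝ} (hδ : ∀ i, 0 ≤ δ i)
      (hdet : (1 - Matrix.diagonal δ * M).det = 0) : 1 ≤ M k k * ∑ i, δ i :=
    one_le_mul_sum_of_det_one_sub_diagonal_mul_eq_zero hM hd hk hδ hdet
  unfold nuC
  rcases (hM k k).eq_or_lt with h0 | hpos
  · rw [← h0, inv_eq_zero]
    convert Real.sInf_empty
    refine Set.eq_empty_of_forall_notMem ?_
    rintro s ⟨δ, hδ, hdet, -⟩
    have := hlower hδ hdet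
    rw [← h0, zero_mul] at this
    exact absurd this (by norm_num)
  · rw [inv_eq_iff_eq_inv]
    refine IsLeast.csInf_eq ⟨⟨Pi.single k (M k k)⁻¹, ?_,
      det_one_sub_diagonal_single_inv_mul M hpos.ne', by simp⟩, ?_⟩
    · intro i
      by_cases hi : i = k
      · subst hi
        simpa using hpos.le
      · simp [hi]
    · rintro s ⟨δ, hδ, hdet, rfl⟩
      exact (inv_le_iff_one_le_mul₀' hpos).mpr (hlower hδ hdet)

/-- If `D M D⁻¹` is diagonally maximal for some positive diagonal `D`, then
`ν̄(M) = ν_C(M)`. -/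
theorem nuBar_eq_nuC_of_diagonallyMaximal {n : ℕ} (hn : 1 ≤ n)
    (M : Matrix (Fin n) (Fin n) ℝ) (hM : ∀ i j, 0 ≤ M i j)
    (h : ∃ d : Fin n → ℝ, (∀ i, 0 < d i) ∧
      DiagonallyMaximal (Matrix.diagonal d * M * Matrix.diagonal (fun i => (d i)⁻¹))) :
    nuBar M = nuC M := by
  obtain ⟨d, hd, hmax⟩ := h
  have : Nonempty (Fin n) := ⟨⟨0, hn⟩⟩
  have hentry (i j : Fin n) :
      (Matrix.diagonal d * M * Matrix.diagonal (fun i => (d i)⁻¹)) i j = M i j * d i / d j := by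
    rw [Matrix.mul_diagonal, Matrix.diagonal_mul, mul_comm (d i), div_eq_mul_inv]
  have hdiag (i : Fin n) : M i i * d i / d i = M i i := mul_div_cancel_right₀ _ (hd i).ne'
  simp only [DiagonallyMaximal, hentry, hdiag] at hmax
  obtain ⟨k, hk⟩ := exists_eq_ciSup_of_finite (f := fun i => M i i)
  rw [← hk] at hmax
  rw [nuBar_eq_apply_self M hd hmax, nuC_eq_apply_self hM hd fun i j =>
    (le_ciSup_ciSup_of_finite (fun i j => M i j * d i / d j) i j).trans_eq hmax]
end

section
/- Let M = [[x, 1],[1, y]] ∈ ℝ^{2×2} with x, y ≥ 0. If x > 1 or y > 1, then ν_C(M) = max{x, y}. -/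
open Matrix BigOperators

theorem det_one_sub_diagonal_mul_two (x y : ℝ) (δ : Fin 2 → ℝ) :
    (1 - Matrix.diagonal δ * !![x, 1; 1, y]).det =
      (1 - δ 0 * x) * (1 - δ 1 * y) - δ 0 * δ 1 := by
  simp [Matrix.det_fin_two, Matrix.diagonal_mul]

theorem one_le_add_mul_of_singular {x y m a b : ℝ} (hxm : x ≤ m) (hym : y ≤ m) (hm : 1 ≤ m)
    (ha : 0 ≤ a) (hb : 0 ≤ b) (hab : (1 - a * x) * (1 - b * y) - a * b = 0) :
    1 ≤ (a + b) * m := by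
  by_contra! hlt
  have ham : 0 ≤ a * m := by positivity
  have hbm : 0 ≤ b * m := by positivity
  have hprod : (1 - a * m) * (1 - b * m) ≤ (1 - a * x) * (1 - b * y) := by
    have hax : a * x ≤ a * m := by gcongr
    have hby : b * y ≤ b * m := by gcongr
    apply mul_le_mul <;> linarith
  have hsq : a * b ≤ (a * m) * (b * m) :=
    mul_le_mul (le_mul_of_one_le_right ha hm) (le_mul_of_one_le_right hb hm) hb ham
  linarith

/-- For `M = [[x, 1], [1, y]]` with `x, y ≥ 0`: if `x > 1` or `y > 1`, then
`ν_C(M) = max {x, y}`. -/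
theorem nuC_two_by_two_large {x y : ℝ} (hx : 0 ≤ x) (hy : 0 ≤ y)
    (h : 1 < x ∨ 1 < y) :
    nuC !![x, 1; 1, y] = max x y := by
  have hm : 1 < max x y := lt_max_iff.mpr h
  have hm0 : 0 < max x y := one_pos.trans hm
  rw [nuC, inv_eq_iff_eq_inv]
  refine IsLeast.csInf_eq ⟨?_, ?_⟩
  · rcases le_total y x with hyx | hxy
    · rw [max_eq_left hyx] at hm0 ⊢
      refine ⟨![x⁻¹, 0], by simp [Fin.forall_fin_two, hx], ?_, by simp⟩
      simp [det_one_sub_diagonal_mul_two, hm0.ne']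
    · rw [max_eq_right hxy] at hm0 ⊢
      refine ⟨![0, y⁻¹], by simp [Fin.forall_fin_two, hy], ?_, by simp⟩
      simp [det_one_sub_diagonal_mul_two, hm0.ne']
  · rintro s ⟨δ, hδ, hdet, rfl⟩
    rw [det_one_sub_diagonal_mul_two] at hdet
    rw [Fin.sum_univ_two, inv_le_iff_one_le_mul₀ hm0]
    exact one_le_add_mul_of_singular (le_max_left x y) (le_max_right x y) hm.le
      (hδ 0) (hδ 1) hdet
end

section
/- Let M = [[x, 1],[1, y]] ∈ ℝ^{2×2} with 0 < x < 1 and 0 < y < 1, and set δ*_11 = (1 − y)/(1 − xy) and δ*_22 = (1 − x)/(1 − xy). Then Δ* = diag(δ*_11, δ*_22) has nonnegative diagonal entries, I − Δ*M is singular, and δ*_11 + δ*_22 = (2 − x − y)/(1 − xy) equals the infimum of δ_11 + δ_22 over all diagonal Δ with nonnegative diagonal entries making I − ΔM singular; i.e., Δ* attains the infimum defining ν_C(M). -/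
open Matrix BigOperators

/-- Singularity of `I - diag(a, b) * [[x, 1], [1, y]]` as a polynomial equation. -/
lemma det_one_sub_diagonal_mul (δ : Fin 2 → ℝ) (x y : ℝ) :
    (1 - Matrix.diagonal δ * !![x, 1; 1, y]).det =
      (1 - δ 0 * x) * (1 - δ 1 * y) - δ 0 * δ 1 := by
  simp [Matrix.det_fin_two, Matrix.diagonal_mul]

/-- The singularity equation says `((1 - xy) a + y) ((1 - xy) b + x) = 1`, so AM-GM bounds
`a + b` from below. -/
lemma div_le_add_of_singular {x y a b : ℝ} (hx : 0 < x) (hy : 0 < y) (hxy : 0 < 1 - x * y)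
    (ha : 0 ≤ a) (hb : 0 ≤ b) (h : (1 - a * x) * (1 - b * y) - a * b = 0) :
    (2 - x - y) / (1 - x * y) ≤ a + b := by
  have hA : 0 < (1 - x * y) * a + y := by positivity
  have hB : 0 < (1 - x * y) * b + x := by positivity
  have hAB : ((1 - x * y) * a + y) * ((1 - x * y) * b + x) = 1 := by
    linear_combination (-(1 - x * y)) * h
  rw [div_le_iff₀ hxy]
  nlinarith [sq_nonneg (((1 - x * y) * a + y) - ((1 - x * y) * b + x))]

/-- For `M = [[x, 1], [1, y]]` with `0 < x < 1`, `0 < y < 1`, set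
`δ*_11 = (1 − y)/(1 − xy)` and `δ*_22 = (1 − x)/(1 − xy)`.  Then
`Δ* = diag(δ*_11, δ*_22)` has nonnegative diagonal entries, `I − Δ* M` is
singular, and `δ*_11 + δ*_22 = (2 − x − y)/(1 − xy)` equals the infimum of
`δ_11 + δ_22` over all nonnegative diagonal `Δ` making `I − ΔM` singular;
i.e. `Δ*` attains the infimum defining `ν_C(M)`. -/
theorem two_by_two_optimal_delta {x y : ℝ} (hx0 : 0 < x) (hx1 : x < 1)
    (hy0 : 0 < y) (hy1 : y < 1) :
    0 ≤ (1 - y) / (1 - x * y) ∧ 0 ≤ (1 - x) / (1 - x * y) ∧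
    (1 - Matrix.diagonal ![(1 - y) / (1 - x * y), (1 - x) / (1 - x * y)] *
        !![x, 1; 1, y]).det = 0 ∧
    (1 - y) / (1 - x * y) + (1 - x) / (1 - x * y) = (2 - x - y) / (1 - x * y) ∧
    (1 - y) / (1 - x * y) + (1 - x) / (1 - x * y) =
      sInf {s : ℝ | ∃ δ : Fin 2 → ℝ, (∀ i, 0 ≤ δ i) ∧
        (1 - Matrix.diagonal δ * !![x, 1; 1, y]).det = 0 ∧ s = ∑ i, δ i} := by
  have hD : 0 < 1 - x * y := by nlinarith
  have ha : 0 ≤ (1 - y) / (1 - x * y) := div_nonneg (by linarith) hD.le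
  have hb : 0 ≤ (1 - x) / (1 - x * y) := div_nonneg (by linarith) hD.le
  have hdet : (1 - Matrix.diagonal ![(1 - y) / (1 - x * y), (1 - x) / (1 - x * y)] *
      !![x, 1; 1, y]).det = 0 := by
    rw [det_one_sub_diagonal_mul]
    simp only [Matrix.cons_val_zero, Matrix.cons_val_one]
    have h₁ : 1 - (1 - y) / (1 - x * y) * x = (1 - x) / (1 - x * y) := by
      rw [eq_div_iff hD.ne', sub_mul, mul_right_comm, div_mul_cancel₀ _ hD.ne']
      ring
    have h₂ : 1 - (1 - x) / (1 - x * y) * y = (1 - y) / (1 - x * y) := by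
      rw [eq_div_iff hD.ne', sub_mul, mul_right_comm, div_mul_cancel₀ _ hD.ne']
      ring
    rw [h₁, h₂]
    ring
  have hsum : (1 - y) / (1 - x * y) + (1 - x) / (1 - x * y) = (2 - x - y) / (1 - x * y) := by
    rw [← add_div]
    ring
  refine ⟨ha, hb, hdet, hsum, (IsLeast.csInf_eq ⟨?_, ?_⟩).symm⟩
  · refine ⟨_, ?_, hdet, by simp [Fin.sum_univ_two]⟩
    intro i
    fin_cases i
    exacts [ha, hb]
  · rintro s ⟨δ, hδ, h, rfl⟩
    rw [hsum, Fin.sum_univ_two]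
    rw [det_one_sub_diagonal_mul] at h
    exact div_le_add_of_singular hx0 hy0 hD (hδ 0) (hδ 1) h
end

section
/- For every nonnegative matrix M ∈ ℝ^{n×n}, the optimal diagonally scaled maximum row sum equals the optimal diagonally scaled maximum column sum: inf{ max_i Σ_j M_ij·d_i/d_j : d ∈ ℝ^n, d_i > 0 for all i } = inf{ max_j Σ_i M_ij·d_i/d_j : d ∈ ℝ^n, d_i > 0 for all i }. -/
open Matrix BigOperators

/-- If a nonnegative matrix satisfies `A x ≤ q x` for a positive vector `x` and some `q < 1`,
then its transpose satisfies `Aᵀ y ≤ y` for some positive vector `y`. -/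
theorem exists_pos_vecMul_le {ι : Type*} [Fintype ι] [DecidableEq ι]
    {A : Matrix ι ι ℝ} (hA : ∀ i j, 0 ≤ A i j) {x : ι → ℝ} (hx : ∀ i, 0 < x i) {q : ℝ}
    (hq0 : 0 ≤ q) (hq1 : q < 1) (h : ∀ i, (A *ᵥ x) i ≤ q * x i) :
    ∃ y : ι → ℝ, (∀ i, 0 < y i) ∧ ∀ j, (y ᵥ* A) j ≤ y j := by
  set u : ℕ → ι → ℝ := fun k => 1 ᵥ* A ^ k with hu
  have u_zero : u 0 = 1 := by simp [hu]
  have u_succ (k : ℕ) : u (k + 1) = u k ᵥ* A := by simp [hu, pow_succ, vecMul_vecMul]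
  have u_nonneg (k : ℕ) : ∀ i, 0 ≤ u k i := by
    induction k with
    | zero => simp [u_zero]
    | succ k ih =>
      intro i
      rw [u_succ]
      exact Finset.sum_nonneg fun j _ => mul_nonneg (ih j) (hA j i)
  have dot_le (k : ℕ) : u k ⬝ᵥ x ≤ q ^ k * ((1 : ι → ℝ) ⬝ᵥ x) := by
    induction k with
    | zero => simp [u_zero]
    | succ k ih =>
      calc u (k + 1) ⬝ᵥ x = u k ⬝ᵥ (A *ᵥ x) := by rw [u_succ, dotProduct_mulVec]
        _ ≤ ∑ i, u k i * (q * x i) :=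
          Finset.sum_le_sum fun i _ => mul_le_mul_of_nonneg_left (h i) (u_nonneg k i)
        _ = q * (u k ⬝ᵥ x) := by
          rw [dotProduct, Finset.mul_sum]
          exact Finset.sum_congr rfl fun i _ => by ring
        _ ≤ q * (q ^ k * ((1 : ι → ℝ) ⬝ᵥ x)) := mul_le_mul_of_nonneg_left ih hq0
        _ = q ^ (k + 1) * ((1 : ι → ℝ) ⬝ᵥ x) := by ring
  have small : ∀ᶠ k in Filter.atTop, ∀ i, q ^ k * ((1 : ι → ℝ) ⬝ᵥ x) < x i := by
    rw [Filter.eventually_all]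
    intro i
    have := (tendsto_pow_atTop_nhds_zero_of_lt_one hq0 hq1).mul_const ((1 : ι → ℝ) ⬝ᵥ x)
    rw [zero_mul] at this
    exact this.eventually_lt_const (hx i)
  obtain ⟨K, hK, hK1⟩ := (small.and (Filter.eventually_ge_atTop 1)).exists
  have u_le (i : ι) : u K i ≤ 1 := by
    have h1 : u K i * x i ≤ u K ⬝ᵥ x :=
      Finset.single_le_sum (f := fun i => u K i * x i)
        (fun j _ => mul_nonneg (u_nonneg K j) (hx j).le) (Finset.mem_univ i)
    have h2 : u K i * x i ≤ 1 * x i := by linarith [dot_le K, hK i]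
    exact le_of_mul_le_mul_right h2 (hx i)
  refine ⟨∑ k ∈ Finset.range K, u k, fun i => ?_, fun j => ?_⟩
  · rw [Finset.sum_apply]
    refine Finset.sum_pos' (fun k _ => u_nonneg k i) ⟨0, Finset.mem_range.2 hK1, ?_⟩
    simp [u_zero]
  · have key : (∑ k ∈ Finset.range K, u k) ᵥ* A + u 0 = ∑ k ∈ Finset.range K, u k + u K := by
      rw [sum_vecMul, ← Finset.sum_range_succ, Finset.sum_range_succ']
      simp only [u_succ]
    have := congrFun key j
    simp only [Pi.add_apply, u_zero, Pi.one_apply] at this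
    linarith [u_le j]

/-- The optimal diagonally scaled maximum column sum of a nonnegative matrix is at most its
optimal diagonally scaled maximum row sum. -/
theorem scaled_col_sum_le_scaled_row_sum {ι : Type*} [Fintype ι] [Nonempty ι]
    {M : Matrix ι ι ℝ} (hM : ∀ i j, 0 ≤ M i j) :
    sInf {v : ℝ | ∃ d : ι → ℝ, (∀ i, 0 < d i) ∧ v = ⨆ j, ∑ i, M i j * d i / d j} ≤
      sInf {v : ℝ | ∃ d : ι → ℝ, (∀ i, 0 < d i) ∧ v = ⨆ i, ∑ j, M i j * d i / d j} := by
  classical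
  refine le_csInf ⟨_, 1, fun _ => one_pos, rfl⟩ ?_
  rintro v ⟨d, hd, rfl⟩
  set v := ⨆ i, ∑ j, M i j * d i / d j
  have hv0 : 0 ≤ v := Real.iSup_nonneg fun i => Finset.sum_nonneg fun j _ =>
    div_nonneg (mul_nonneg (hM i j) (hd i).le) (hd j).le
  refine le_of_forall_gt_imp_ge_of_dense fun w hw => ?_
  have hw0 : 0 < w := hv0.trans_lt hw
  obtain ⟨y, hy, hyA⟩ := exists_pos_vecMul_le (A := w⁻¹ • M) (x := d⁻¹) (q := w⁻¹ * v)
    (fun i j => mul_nonneg (inv_nonneg.2 hw0.le) (hM i j)) (fun i => inv_pos.2 (hd i))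
    (by positivity) (by rw [inv_mul_lt_one₀ hw0]; exact hw) (fun i => by
      have hi : ∑ j, M i j * d i / d j ≤ v :=
        le_ciSup (f := fun i => ∑ j, M i j * d i / d j) (Set.finite_range _).bddAbove i
      have hs : (M *ᵥ d⁻¹) i = (∑ j, M i j * d i / d j) * (d i)⁻¹ := by
        rw [mulVec, dotProduct, Finset.sum_mul]
        refine Finset.sum_congr rfl fun j _ => ?_
        have := (hd i).ne'
        simp only [Pi.inv_apply]
        field_simp
      rw [smul_mulVec, Pi.smul_apply, smul_eq_mul, mul_assoc, hs, Pi.inv_apply]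
      exact mul_le_mul_of_nonneg_left
        (mul_le_mul_of_nonneg_right hi (inv_nonneg.2 (hd i).le)) (inv_nonneg.2 hw0.le))
  have hbdd : BddBelow {v : ℝ | ∃ d : ι → ℝ, (∀ i, 0 < d i) ∧
      v = ⨆ j, ∑ i, M i j * d i / d j} := by
    refine ⟨0, ?_⟩
    rintro _ ⟨e, he, rfl⟩
    exact Real.iSup_nonneg fun j => Finset.sum_nonneg fun i _ =>
      div_nonneg (mul_nonneg (hM i j) (he i).le) (he j).le
  refine (csInf_le hbdd ⟨y, hy, rfl⟩).trans (ciSup_le fun j => ?_)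
  have hj := hyA j
  rw [vecMul_smul, Pi.smul_apply, smul_eq_mul, inv_mul_le_iff₀ hw0] at hj
  rw [← Finset.sum_div, div_le_iff₀ (hy j)]
  refine le_trans (le_of_eq ?_) hj
  exact Finset.sum_congr rfl fun i _ => mul_comm _ _

/-- Inverting the scaling turns scaled row sums into scaled column sums of the transpose. -/
theorem setOf_scaled_row_sum_eq_transpose {ι : Type*} [Fintype ι] (M : Matrix ι ι ℝ) :
    {v : ℝ | ∃ d : ι → ℝ, (∀ i, 0 < d i) ∧ v = ⨆ i, ∑ j, M i j * d i / d j} =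
      {v : ℝ | ∃ d : ι → ℝ, (∀ i, 0 < d i) ∧ v = ⨆ j, ∑ i, Mᵀ i j * d i / d j} := by
  have hterm (d : ι → ℝ) (i j : ι) : M i j * d i / d j = M i j * d⁻¹ j / d⁻¹ i := by
    simp only [Pi.inv_apply, div_eq_mul_inv, inv_inv]
    ring
  ext v
  constructor
  · rintro ⟨d, hd, rfl⟩
    exact ⟨d⁻¹, fun i => inv_pos.2 (hd i), by simp only [transpose_apply, hterm d]⟩
  · rintro ⟨d, hd, rfl⟩
    exact ⟨d⁻¹, fun i => inv_pos.2 (hd i), by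
      simp only [transpose_apply, hterm d⁻¹, inv_inv]⟩

/-- For every nonnegative matrix `M ∈ ℝ^{n×n}`, the optimal diagonally scaled
maximum row sum equals the optimal diagonally scaled maximum column sum:
`inf_{d > 0} max_i Σ_j M_ij d_i/d_j = inf_{d > 0} max_j Σ_i M_ij d_i/d_j`. -/
theorem scaled_row_sum_eq_scaled_col_sum {n : ℕ} (hn : 1 ≤ n)
    (M : Matrix (Fin n) (Fin n) ℝ) (hM : ∀ i j, 0 ≤ M i j) :
    sInf {v : ℝ | ∃ d : Fin n → ℝ, (∀ i, 0 < d i) ∧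
        v = ⨆ i, ∑ j, M i j * d i / d j} =
      sInf {v : ℝ | ∃ d : Fin n → ℝ, (∀ i, 0 < d i) ∧
        v = ⨆ j, ∑ i, M i j * d i / d j} := by
  have : Nonempty (Fin n) := ⟨⟨0, hn⟩⟩
  refine le_antisymm ?_ (scaled_col_sum_le_scaled_row_sum hM)
  have := scaled_col_sum_le_scaled_row_sum (M := Mᵀ) fun i j => hM j i
  rwa [← setOf_scaled_row_sum_eq_transpose, setOf_scaled_row_sum_eq_transpose Mᵀ,
    transpose_transpose] at this
end
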